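/- For every series-parallel extension Q' of Q = ns(3,8,3) and every ε > 0, there exists a workload t on the activities of Q such that T(Q',t)/T(Q,t) ≥ 3/(1+2ε); in particular, with ε = 1/10 the slowdown is at least 5/2 > 2, disproving the conjecture that some SP extension achieves slowdown at most 2 for all workloads. -/

import Mathlib

/-- A finset is a chain w.r.t. relation `E`: any two distinct members are comparable. -/
def IsChainIn {V : Type*} (E : V → V → Prop) (C : Finset V) : Prop :=
  ∀ a ∈ C, ∀ b ∈ C, a ≠ b → E a b ∨ E b a

/-- Makespan: supremum over chains of total duration. -/
noncomputable def makespan {V : Type*} [Fintype V] [DecidableEq V]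
    (E : V → V → Prop) (t : V → ℝ) : ℝ :=
  sSup {x | ∃ C : Finset V, IsChainIn E C ∧ x = ∑ a ∈ C, t a}

/-- Level of an activity: maximum size of a chain ending at `a`. -/
noncomputable def level {V : Type*} [Fintype V] [DecidableEq V]
    (E : V → V → Prop) (a : V) : ℕ :=
  sSup {n | ∃ C : Finset V, IsChainIn E C ∧ a ∈ C ∧ (∀ b ∈ C, b ≠ a → E b a) ∧ C.card = n}

/-- Depth: size of a longest chain. -/
noncomputable def depth {V : Type*} [Fintype V] [DecidableEq V]
    (E : V → V → Prop) : ℕ :=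
  sSup {n | ∃ C : Finset V, IsChainIn E C ∧ C.card = n}

/-- One generating precedence constraint of the neighbour-synchronisation
network ns(d,w,3): from a_{i,j} to a_{i+1,j+k}, k ∈ {−1,0,1}. -/
def nsStep (d w : ℕ) (a b : Fin d × Fin w) : Prop :=
  (b.1 : ℕ) = (a.1 : ℕ) + 1 ∧ ((b.2 : ℤ) - (a.2 : ℤ)).natAbs ≤ 1

/-- The precedence relation of ns(d,w,3): transitive closure of the generators. -/
def nsRel (d w : ℕ) : Fin d × Fin w → Fin d × Fin w → Prop :=
  Relation.TransGen (nsStep d w)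

/-- An induced N: four distinct elements a,b,c,d with a<c, a<d, b<d and
a,b incomparable, c,d incomparable, b,c incomparable. -/
def HasInducedN {V : Type*} (E : V → V → Prop) : Prop :=
  ∃ a b c d : V, a ≠ b ∧ a ≠ c ∧ a ≠ d ∧ b ≠ c ∧ b ≠ d ∧ c ≠ d ∧
    E a c ∧ E a d ∧ E b d ∧
    ¬ E a b ∧ ¬ E b a ∧ ¬ E c d ∧ ¬ E d c ∧ ¬ E b c ∧ ¬ E c b

/-- Closed form of the precedence relation of `ns(3,8,3)`. -/
def nsClosed (a b : Fin 3 × Fin 8) : Prop :=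
  (a.1 : ℕ) < (b.1 : ℕ) ∧ ((b.2 : ℤ) - (a.2 : ℤ)).natAbs ≤ (b.1 : ℕ) - (a.1 : ℕ)

instance (a b : Fin 3 × Fin 8) : Decidable (nsClosed a b) := by
  unfold nsClosed; infer_instance

/-- Incomparability in the closed form. -/
def nsInc (a b : Fin 3 × Fin 8) : Prop := a ≠ b ∧ ¬ nsClosed a b ∧ ¬ nsClosed b a

instance (a b : Fin 3 × Fin 8) : Decidable (nsInc a b) := by
  unfold nsInc; infer_instance

theorem nsClosed_of_nsRel {a b : Fin 3 × Fin 8} (h : nsRel 3 8 a b) : nsClosed a b := by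
  unfold nsRel at h
  induction h with
  | single h => unfold nsStep at h; unfold nsClosed; omega
  | tail _ h ih => unfold nsStep at h; unfold nsClosed at *; omega

theorem nsRel_of_nsClosed {a b : Fin 3 × Fin 8} (h : nsClosed a b) : nsRel 3 8 a b := by
  obtain ⟨⟨i, hi⟩, ⟨j, hj⟩⟩ := a
  obtain ⟨⟨k, hk⟩, ⟨l, hl⟩⟩ := b
  simp only [nsClosed] at h
  by_cases hik : k = i + 1
  · refine Relation.TransGen.single ?_
    simp only [nsStep]; omega
  · refine Relation.TransGen.tail (b := (⟨1, by omega⟩, ⟨(j + l) / 2, by omega⟩))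
      (Relation.TransGen.single ?_) ?_
    · simp only [nsStep]; omega
    · simp only [nsStep]; omega

/-- No series-parallel extension avoids turning a 3-antichain into a chain. -/
theorem ns383_core (E : Fin 3 × Fin 8 → Fin 3 × Fin 8 → Prop)
    (hT : ∀ {x y z}, E x y → E y z → E x z)
    (hQ : ∀ x y, nsClosed x y → E x y)
    (hF : ∀ {x y z}, nsInc x y ∧ nsInc y z ∧ nsInc x z → E x y → E y z → False)
    (hN : ∀ {a b c d}, E a c → E a d → E b d → ¬ E a b → ¬ E b a → ¬ E c d → ¬ E d c →
      ¬ E b c → ¬ E c b → False) : False := by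
  rcases Classical.em (E (0,1) (2,5)) with ha1c5 | na1c5
  · rcases Classical.em (E (1,3) (2,5)) with hb3c5 | nb3c5
    · have na2a1 : ¬ E (0,2) (0,1) := fun h => hF (by decide) h ha1c5
      have na1b3 : ¬ E (0,1) (1,3) := fun h => hF (by decide) h hb3c5
      have na1a2 : ¬ E (0,1) (0,2) := fun h => na1b3 (hT h (hQ (0,2) (1,3) (by decide)))
      have nb1b3 : ¬ E (1,1) (1,3) := fun h => hF (by decide) h hb3c5
      have nb3a1 : ¬ E (1,3) (0,1) := fun h => hF (by decide) h ha1c5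
      have hb3b1 : E (1,3) (1,1) := Classical.byContradiction fun h => hN (hQ (0,2) (1,3) (by decide)) (hQ (0,2) (1,1) (by decide)) (hQ (0,1) (1,1) (by decide)) na2a1 na1a2 h nb1b3 na1b3 nb3a1
      have nb1b2 : ¬ E (1,1) (1,2) := fun h => hF (by decide) hb3b1 h
      have nb2b3 : ¬ E (1,2) (1,3) := fun h => hF (by decide) h hb3c5
      have hb3b2 : E (1,3) (1,2) := Classical.byContradiction fun h => hN (hQ (0,2) (1,3) (by decide)) (hQ (0,2) (1,2) (by decide)) (hQ (0,1) (1,2) (by decide)) na2a1 na1a2 h nb2b3 na1b3 nb3a1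
      have nb2b1 : ¬ E (1,2) (1,1) := fun h => hF (by decide) hb3b2 h
      have nc0b3 : ¬ E (2,0) (1,3) := fun h => hF (by decide) h hb3c5
      have hb3c0 : E (1,3) (2,0) := Classical.byContradiction fun h => hN (hQ (0,2) (1,3) (by decide)) (hQ (0,2) (2,0) (by decide)) (hQ (0,1) (2,0) (by decide)) na2a1 na1a2 h nc0b3 na1b3 nb3a1
      have nc0c1 : ¬ E (2,0) (2,1) := fun h => hF (by decide) hb3c0 h
      have nc1b3 : ¬ E (2,1) (1,3) := fun h => hF (by decide) h hb3c5
      have hb3c1 : E (1,3) (2,1) := Classical.byContradiction fun h => hN (hQ (0,2) (1,3) (by decide)) (hQ (0,2) (2,1) (by decide)) (hQ (0,1) (2,1) (by decide)) na2a1 na1a2 h nc1b3 na1b3 nb3a1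
      have nc1c0 : ¬ E (2,1) (2,0) := fun h => hF (by decide) hb3c1 h
      have nb2c0 : ¬ E (1,2) (2,0) := fun h => hF (by decide) hb3b2 h
      have nc0b2 : ¬ E (2,0) (1,2) := fun h => hF (by decide) hb3c0 h
      exact hN (hQ (1,1) (2,0) (by decide)) (hQ (1,1) (2,1) (by decide)) (hQ (1,2) (2,1) (by decide)) nb1b2 nb2b1 nc0c1 nc1c0 nb2c0 nc0b2
    · have nb3a6 : ¬ E (1,3) (0,6) := fun h => nb3c5 (hT h (hQ (0,6) (2,5) (by decide)))
      have nc5c4 : ¬ E (2,5) (2,4) := fun h => hF (by decide) ha1c5 h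
      have nc4c5 : ¬ E (2,4) (2,5) := fun h => nb3c5 (hT (hQ (1,3) (2,4) (by decide)) h)
      have nc5b3 : ¬ E (2,5) (1,3) := fun h => hF (by decide) ha1c5 h
      have ha6b3 : E (0,6) (1,3) := Classical.byContradiction fun h => hN (hQ (0,6) (2,5) (by decide)) (hQ (0,6) (2,4) (by decide)) (hQ (1,3) (2,4) (by decide)) h nb3a6 nc5c4 nc4c5 nb3c5 nc5b3
      have na5a6 : ¬ E (0,5) (0,6) := fun h => hF (by decide) h ha6b3
      have nb3a5 : ¬ E (1,3) (0,5) := fun h => nb3c5 (hT h (hQ (0,5) (2,5) (by decide)))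
      have ha5b3 : E (0,5) (1,3) := Classical.byContradiction fun h => hN (hQ (0,5) (2,5) (by decide)) (hQ (0,5) (2,4) (by decide)) (hQ (1,3) (2,4) (by decide)) h nb3a5 nc5c4 nc4c5 nb3c5 nc5b3
      have na6a5 : ¬ E (0,6) (0,5) := fun h => hF (by decide) h ha5b3
      have nb3b5 : ¬ E (1,3) (1,5) := fun h => nb3c5 (hT h (hQ (1,5) (2,5) (by decide)))
      have hb5b3 : E (1,5) (1,3) := Classical.byContradiction fun h => hN (hQ (1,5) (2,5) (by decide)) (hQ (1,5) (2,4) (by decide)) (hQ (1,3) (2,4) (by decide)) h nb3b5 nc5c4 nc4c5 nb3c5 nc5b3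
      have nb4b5 : ¬ E (1,4) (1,5) := fun h => hF (by decide) h hb5b3
      have nb3b4 : ¬ E (1,3) (1,4) := fun h => nb3c5 (hT h (hQ (1,4) (2,5) (by decide)))
      have hb4b3 : E (1,4) (1,3) := Classical.byContradiction fun h => hN (hQ (1,4) (2,5) (by decide)) (hQ (1,4) (2,4) (by decide)) (hQ (1,3) (2,4) (by decide)) h nb3b4 nc5c4 nc4c5 nb3c5 nc5b3
      have nb5b4 : ¬ E (1,5) (1,4) := fun h => hF (by decide) h hb4b3
      have na6b4 : ¬ E (0,6) (1,4) := fun h => hF (by decide) h hb4b3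
      have nb4a6 : ¬ E (1,4) (0,6) := fun h => hF (by decide) h ha6b3
      exact hN (hQ (0,5) (1,4) (by decide)) (hQ (0,5) (1,5) (by decide)) (hQ (0,6) (1,5) (by decide)) na5a6 na6a5 nb4b5 nb5b4 na6b4 nb4a6
  · rcases Classical.em (E (1,4) (0,1)) with hb4a1 | nb4a1
    · have hb4b1 : E (1,4) (1,1) := hT hb4a1 (hQ (0,1) (1,1) (by decide))
      have nb1b0 : ¬ E (1,1) (1,0) := fun h => hF (by decide) hb4b1 h
      have hb4b0 : E (1,4) (1,0) := hT hb4a1 (hQ (0,1) (1,0) (by decide))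
      have nb0b1 : ¬ E (1,0) (1,1) := fun h => hF (by decide) hb4b0 h
      have hb4c2 : E (1,4) (2,2) := hT hb4a1 (hQ (0,1) (2,2) (by decide))
      have nc2c0 : ¬ E (2,2) (2,0) := fun h => hF (by decide) hb4c2 h
      have hb4c0 : E (1,4) (2,0) := hT hb4a1 (hQ (0,1) (2,0) (by decide))
      have nc0c2 : ¬ E (2,0) (2,2) := fun h => hF (by decide) hb4c0 h
      have nb0c2 : ¬ E (1,0) (2,2) := fun h => hF (by decide) hb4b0 h
      have nc2b0 : ¬ E (2,2) (1,0) := fun h => hF (by decide) hb4c2 h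
      exact hN (hQ (1,1) (2,2) (by decide)) (hQ (1,1) (2,0) (by decide)) (hQ (1,0) (2,0) (by decide)) nb1b0 nb0b1 nc2c0 nc0c2 nb0c2 nc2b0
    · have na1b4 : ¬ E (0,1) (1,4) := fun h => na1c5 (hT h (hQ (1,4) (2,5) (by decide)))
      have nc3c5 : ¬ E (2,3) (2,5) := fun h => na1c5 (hT (hQ (0,1) (2,3) (by decide)) h)
      have nc5a1 : ¬ E (2,5) (0,1) := fun h => nb4a1 (hT (hQ (1,4) (2,5) (by decide)) h)
      have hc5c3 : E (2,5) (2,3) := Classical.byContradiction fun h => hN (hQ (1,4) (2,5) (by decide)) (hQ (1,4) (2,3) (by decide)) (hQ (0,1) (2,3) (by decide)) nb4a1 na1b4 h nc3c5 na1c5 nc5a1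
      have ha7c3 : E (0,7) (2,3) := hT (hQ (0,7) (2,5) (by decide)) hc5c3
      have na6a7 : ¬ E (0,6) (0,7) := fun h => hF (by decide) h ha7c3
      have ha6c3 : E (0,6) (2,3) := hT (hQ (0,6) (2,5) (by decide)) hc5c3
      have na7a6 : ¬ E (0,7) (0,6) := fun h => hF (by decide) h ha6c3
      have hb6c3 : E (1,6) (2,3) := hT (hQ (1,6) (2,5) (by decide)) hc5c3
      have nb5b6 : ¬ E (1,5) (1,6) := fun h => hF (by decide) h hb6c3
      have hb5c3 : E (1,5) (2,3) := hT (hQ (1,5) (2,5) (by decide)) hc5c3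
      have nb6b5 : ¬ E (1,6) (1,5) := fun h => hF (by decide) h hb5c3
      have na7b5 : ¬ E (0,7) (1,5) := fun h => hF (by decide) h hb5c3
      have nb5a7 : ¬ E (1,5) (0,7) := fun h => hF (by decide) h ha7c3
      exact hN (hQ (0,6) (1,5) (by decide)) (hQ (0,6) (1,6) (by decide)) (hQ (0,7) (1,6) (by decide)) na6a7 na7a6 nb5b6 nb6b5 na7b5 nb5a7

theorem ns383_exists_triple (E' : Fin 3 × Fin 8 → Fin 3 × Fin 8 → Prop)
    (htrans : Transitive E') (hirr : Irreflexive E')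
    (hext : ∀ a b, nsRel 3 8 a b → E' a b) (hSP : ¬ HasInducedN E') :
    ∃ x y z, (nsInc x y ∧ nsInc y z ∧ nsInc x z) ∧ E' x y ∧ E' y z := by
  by_contra hno
  refine ns383_core E' (fun h1 h2 => htrans h1 h2)
    (fun x y h => hext x y (nsRel_of_nsClosed h))
    (fun h h1 h2 => hno ⟨_, _, _, h, h1, h2⟩) ?_
  intro a b c d hac had hbd h1 h2 h3 h4 h5 h6
  refine hSP ⟨a, b, c, d, ?_, ?_, ?_, ?_, ?_, ?_, hac, had, hbd, h1, h2, h3, h4, h5, h6⟩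
  · rintro rfl; exact h5 hac
  · rintro rfl; exact hirr _ hac
  · rintro rfl; exact hirr _ had
  · rintro rfl; exact h3 hbd
  · rintro rfl; exact hirr _ hbd
  · rintro rfl; exact h5 hbd

theorem ns383_chain_card {C : Finset (Fin 3 × Fin 8)} (hC : IsChainIn (nsRel 3 8) C) :
    C.card ≤ 3 := by
  have h : C.card ≤ (Finset.univ : Finset (Fin 3)).card := by
    refine Finset.card_le_card_of_injOn Prod.fst (fun _ _ => Finset.mem_univ _) ?_
    intro a ha b hb hab
    by_contra hne
    rcases hC a ha b hb hne with h | h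
    · have := (nsClosed_of_nsRel h).1
      rw [hab] at this; omega
    · have := (nsClosed_of_nsRel h).1
      rw [hab] at this; omega
  simpa using h

theorem makespan_bddAbove {V : Type*} [Fintype V] [DecidableEq V]
    (E : V → V → Prop) (t : V → ℝ) :
    BddAbove {x | ∃ C : Finset V, IsChainIn E C ∧ x = ∑ a ∈ C, t a} := by
  refine ((Set.finite_range (fun C : Finset V => ∑ a ∈ C, t a)).subset ?_).bddAbove
  rintro x ⟨C, _, rfl⟩
  exact ⟨C, rfl⟩

/-- for every series-parallel (N-free) extension Q' of
Q = ns(3,8,3) and every ε > 0, some workload forces slowdown at least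
3/(1+2ε); in particular for ε = 1/10 the slowdown is at least 5/2 > 2. -/
theorem ns383_sp_extension_slowdown
    (E' : Fin 3 × Fin 8 → Fin 3 × Fin 8 → Prop)
    (htrans : Transitive E') (hirr : Irreflexive E')
    (hext : ∀ a b, nsRel 3 8 a b → E' a b)
    (hSP : ¬ HasInducedN E') :
    ∀ ε : ℝ, 0 < ε → ∃ t : Fin 3 × Fin 8 → ℝ, (∀ a, 0 < t a) ∧
      makespan E' t / makespan (nsRel 3 8) t ≥ 3 / (1 + 2 * ε) := by
  intro ε hε
  obtain ⟨x, y, z, ⟨hxy, hyz, hxz⟩, exy, eyz⟩ := ns383_exists_triple E' htrans hirr hext hSP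
  set δ : ℝ := min ε 1 with hδ
  have hδ0 : 0 < δ := lt_min hε one_pos
  have hδ1 : δ ≤ 1 := min_le_right _ _
  have hδε : δ ≤ ε := min_le_left _ _
  set S : Finset (Fin 3 × Fin 8) := {x, y, z} with hS
  have hincS : ∀ a ∈ S, ∀ b ∈ S, a ≠ b → ¬ nsClosed a b := by
    intro a ha b hb hab
    simp only [hS, Finset.mem_insert, Finset.mem_singleton] at ha hb
    unfold nsInc at hxy hyz hxz
    rcases ha with rfl | rfl | rfl <;> rcases hb with rfl | rfl | rfl <;> tauto
  let t : Fin 3 × Fin 8 → ℝ := fun a => δ + if a ∈ S then 1 - δ else 0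
  have htpos : ∀ a, 0 < t a := by
    intro a
    simp only [t]
    split_ifs <;> linarith
  refine ⟨t, htpos, ?_⟩
  have hupper : makespan (nsRel 3 8) t ≤ 1 + 2 * ε := by
    refine csSup_le ⟨0, ∅, by simp [IsChainIn], by simp⟩ ?_
    rintro v ⟨C, hC, rfl⟩
    have hc3 : (C.card : ℝ) ≤ 3 := by exact_mod_cast ns383_chain_card hC
    have hc1 : ((C.filter (· ∈ S)).card : ℝ) ≤ 1 := by
      have : (C.filter (· ∈ S)).card ≤ 1 := by
        rw [Finset.card_le_one]
        intro a ha b hb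
        rw [Finset.mem_filter] at ha hb
        by_contra hne
        rcases hC a ha.1 b hb.1 hne with h | h
        · exact hincS a ha.2 b hb.2 hne (nsClosed_of_nsRel h)
        · exact hincS b hb.2 a ha.2 (Ne.symm hne) (nsClosed_of_nsRel h)
      exact_mod_cast this
    have hsum : ∑ a ∈ C, t a = C.card * δ + (C.filter (· ∈ S)).card * (1 - δ) := by
      simp only [t]
      rw [Finset.sum_add_distrib, ← Finset.sum_filter]
      simp only [Finset.sum_const, nsmul_eq_mul]
    rw [hsum]
    nlinarith
  have hlow0 : 0 < makespan (nsRel 3 8) t := by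
    refine lt_of_lt_of_le (htpos x) (le_csSup (makespan_bddAbove _ _) ⟨{x}, ?_, by simp⟩)
    intro a ha b hb hab
    simp only [Finset.mem_singleton] at ha hb
    exact absurd (ha.trans hb.symm) hab
  have hlower : 3 ≤ makespan E' t := by
    refine le_csSup (makespan_bddAbove _ _) ⟨S, ?_, ?_⟩
    · have exz := htrans exy eyz
      intro a ha b hb hab
      simp only [hS, Finset.mem_insert, Finset.mem_singleton] at ha hb
      rcases ha with rfl | rfl | rfl <;> rcases hb with rfl | rfl | rfl <;> tauto
    · have h1 : ∑ a ∈ S, t a = ∑ a ∈ S, (1 : ℝ) :=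
        Finset.sum_congr rfl (fun a ha => by simp [t, ha])
      have h2 : S.card = 3 := Finset.card_eq_three.2 ⟨x, y, z, hxy.1, hxz.1, hyz.1, rfl⟩
      rw [h1]; simp [h2]
  exact div_le_div₀ (by linarith) hlower hlow0 hupper
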